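/- Let D ⊆ ℂ be open and f : ℂ × D → ℂ a holomorphic function such that for every w ∈ D the entire function z ↦ f(z,w) is nonconstant. Let a : D → ℂ satisfy f(z,w) ≠ a(w) for all w ∈ D and all z ∈ ℂ. Then the graph {(w, a(w)) : w ∈ D} is a closed subset of D × ℂ. -/

import Mathlib

/-- A nowhere vanishing entire function has an entire logarithm. -/
theorem Complex.exists_differentiable_exp_eq {f : ℂ → ℂ} (hf : Differentiable ℂ f)
    (h0 : ∀ z, f z ≠ 0) :
    ∃ g : ℂ → ℂ, Differentiable ℂ g ∧ ∀ z, Complex.exp (g z) = f z := by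
  have hd : Differentiable ℂ (deriv f) := hf.contDiff.differentiable_deriv_two
  obtain ⟨g, hg0, hg⟩ := (hd.div hf h0).isExactOn_univ.with_val_at 0 (Complex.log (f 0))
  have hg' : ∀ z, HasDerivAt g (deriv f z / f z) z := fun z => hg z (Set.mem_univ z)
  have key : ∀ z, HasDerivAt (fun z => f z * Complex.exp (-g z)) 0 z := by
    intro z
    refine ((hf z).hasDerivAt.fun_mul (hg' z).fun_neg.cexp).congr_deriv ?_
    linear_combination -Complex.exp (-g z) * mul_div_cancel₀ (deriv f z) (h0 z)
  refine ⟨g, fun z => (hg' z).differentiableAt, fun z => ?_⟩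
  have h := is_const_of_deriv_eq_zero (fun z => (key z).differentiableAt)
    (fun z => (key z).deriv) z 0
  simp only [hg0, Complex.exp_neg, Complex.exp_log (h0 0), mul_inv_cancel₀ (h0 0)] at h
  have he := Complex.exp_ne_zero (g z)
  field_simp at h
  exact h.symm

/-- An entire function omitting `1` and `-1` is the cosine of an entire function. -/
theorem Complex.exists_differentiable_cos_eq {f : ℂ → ℂ} (hf : Differentiable ℂ f) (h1 : ∀ z, f z ≠ 1)
    (h2 : ∀ z, f z ≠ -1) : ∃ g : ℂ → ℂ, Differentiable ℂ g ∧ ∀ z, Complex.cos (g z) = f z := by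
  have hne : ∀ z, 1 - f z ^ 2 ≠ 0 := by
    intro z hz
    have : (1 - f z) * (1 + f z) = 0 := by linear_combination hz
    rcases mul_eq_zero.mp this with h | h
    · exact h1 z (by linear_combination -h)
    · exact h2 z (by linear_combination h)
  obtain ⟨k, hk, hke⟩ := Complex.exists_differentiable_exp_eq (f := fun z => 1 - f z ^ 2)
    (by fun_prop) hne
  have hu : ∀ z, Complex.exp (k z / 2) ^ 2 = 1 - f z ^ 2 := by
    intro z
    rw [← Complex.exp_nat_mul, ← hke z]
    congr 1
    push_cast
    ring
  have hmul : ∀ z, (f z + Complex.I * Complex.exp (k z / 2)) *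
      (f z - Complex.I * Complex.exp (k z / 2)) = 1 := by
    intro z
    linear_combination hu z - Complex.exp (k z / 2) ^ 2 * Complex.I_sq
  obtain ⟨l, hl, hle⟩ := Complex.exists_differentiable_exp_eq
    (f := fun z => f z + Complex.I * Complex.exp (k z / 2)) (by fun_prop)
    (fun z hz => by simpa [hz] using hmul z)
  refine ⟨fun z => -Complex.I * l z, by fun_prop, fun z => ?_⟩
  have e1 : -Complex.I * l z * Complex.I = l z := by linear_combination -l z * Complex.I_sq
  have e2 : -(-Complex.I * l z) * Complex.I = -l z := by linear_combination l z * Complex.I_sq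
  have e3 : Complex.exp (-l z) = f z - Complex.I * Complex.exp (k z / 2) := by
    rw [Complex.exp_neg, hle z]
    exact inv_eq_of_mul_eq_one_right (hmul z)
  rw [Complex.cos, e1, e2, e3, hle z]
  ring

/-- If `‖f'‖ ≤ 2 ‖f' p‖` on a ball of radius `r` about `p`, then the range of `f` contains a ball
of radius `r ‖f' p‖ / 24`. -/
theorem Complex.ball_subset_range_of_norm_deriv_le {f : ℂ → ℂ} (hf : Differentiable ℂ f)
    {p : ℂ} {r : ℝ} (hr : 0 < r) (hp : deriv f p ≠ 0)
    (hb : ∀ z ∈ Metric.ball p r, ‖deriv f z‖ ≤ 2 * ‖deriv f p‖) :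
    Metric.ball (f p) (r * ‖deriv f p‖ / 24) ⊆ Set.range f := by
  have hd : Differentiable ℂ (deriv f) := hf.contDiff.differentiable_deriv_two
  have hpos : 0 < ‖deriv f p‖ := norm_pos_iff.mpr hp
  have hschwarz : ∀ z ∈ Metric.ball p r,
      ‖deriv f z - deriv f p‖ ≤ 3 * ‖deriv f p‖ / r * ‖z - p‖ := by
    intro z hz
    simpa [dist_eq_norm] using Complex.dist_le_div_mul_dist_of_mapsTo_ball
      (R₂ := 3 * ‖deriv f p‖) hd.differentiableOn
      (fun w hw => by
        rw [mem_closedBall_iff_norm]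
        linarith [norm_sub_le (deriv f w) (deriv f p), hb w hw]) hz
  have hlin : ∀ z ∈ Metric.sphere p (r / 6),
      ‖(f z - deriv f p * z) - (f p - deriv f p * p)‖ ≤ ‖deriv f p‖ / 2 * ‖z - p‖ := by
    intro z hz
    refine (convex_closedBall p (r / 6)).norm_image_sub_le_of_norm_hasDerivWithin_le
      (f := fun z => f z - deriv f p * z) (f' := fun z => deriv f z - deriv f p) ?_ ?_
      (Metric.mem_closedBall_self (by positivity)) (Metric.sphere_subset_closedBall hz)
    · intro x _
      simpa using ((hf x).hasDerivAt.fun_sub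
        ((hasDerivAt_id x).const_mul (deriv f p))).hasDerivWithinAt
    · intro x hx
      rw [mem_closedBall_iff_norm] at hx
      refine (hschwarz x (by rw [mem_ball_iff_norm]; linarith)).trans ?_
      calc 3 * ‖deriv f p‖ / r * ‖x - p‖ ≤ 3 * ‖deriv f p‖ / r * (r / 6) := by gcongr
        _ = ‖deriv f p‖ / 2 := by field_simp; norm_num
  have hsphere : ∀ z ∈ Metric.sphere p (r / 6), r * ‖deriv f p‖ / 12 ≤ ‖f z - f p‖ := by
    intro z hz
    have h1 := hlin z hz
    have hz' : ‖z - p‖ = r / 6 := mem_sphere_iff_norm.mp hz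
    have h2 : ‖deriv f p * (z - p)‖ = ‖deriv f p‖ * (r / 6) := by rw [norm_mul, hz']
    have h3 := norm_sub_norm_le (deriv f p * (z - p)) (f z - f p)
    have h4 : ‖deriv f p * (z - p) - (f z - f p)‖ =
        ‖(f z - deriv f p * z) - (f p - deriv f p * p)‖ := by
      rw [← norm_neg]
      congr 1
      ring
    rw [hz'] at h1
    nlinarith
  have hfreq : ∃ᶠ z in nhds p, f z ≠ f p := by
    rw [Filter.Frequently]
    intro h
    apply hp
    have : f =ᶠ[nhds p] fun _ => f p := by
      filter_upwards [h] with z hz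
      simpa using hz
    rw [this.deriv_eq, deriv_const]
  have := hf.diffContOnCl.ball_subset_image_closedBall (by positivity : 0 < r / 6) hsphere hfreq
  refine (Metric.ball_subset_ball (by linarith)).trans (this.trans (Set.image_subset_range _ _))

/-- A form of **Bloch's theorem** for entire functions. -/
theorem Complex.exists_ball_subset_range_of_differentiable {f : ℂ → ℂ}
    (hf : Differentiable ℂ f) {z₀ : ℂ}
    (h0 : deriv f z₀ ≠ 0) {R : ℝ} (hR : 0 < R) :
    ∃ c, Metric.ball c (R * ‖deriv f z₀‖ / 48) ⊆ Set.range f := by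
  have hd : Differentiable ℂ (deriv f) := hf.contDiff.differentiable_deriv_two
  obtain ⟨p, hp, hmax⟩ := (isCompact_closedBall z₀ R).exists_isMaxOn
    ⟨z₀, Metric.mem_closedBall_self hR.le⟩
    (f := fun z => (R - ‖z - z₀‖) * ‖deriv f z‖)
    (Continuous.continuousOn (by have := hd.continuous; fun_prop))
  have hmax' : ∀ z ∈ Metric.closedBall z₀ R,
      (R - ‖z - z₀‖) * ‖deriv f z‖ ≤ (R - ‖p - z₀‖) * ‖deriv f p‖ := fun z hz => hmax hz
  have hz := hmax' z₀ (Metric.mem_closedBall_self hR.le)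
  simp only [sub_self, norm_zero, sub_zero] at hz
  have hpos : 0 < ‖deriv f z₀‖ := norm_pos_iff.mpr h0
  rw [mem_closedBall_iff_norm] at hp
  have hprod : 0 < (R - ‖p - z₀‖) * ‖deriv f p‖ := lt_of_lt_of_le (by positivity) hz
  have hs : 0 < R - ‖p - z₀‖ := pos_of_mul_pos_left hprod (norm_nonneg _)
  have hfp : 0 < ‖deriv f p‖ := pos_of_mul_pos_right hprod hs.le
  refine ⟨f p, (Metric.ball_subset_ball ?_).trans
    (Complex.ball_subset_range_of_norm_deriv_le hf (half_pos hs) (norm_pos_iff.mp hfp) ?_)⟩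
  · linarith
  · intro z hz
    rw [mem_ball_iff_norm] at hz
    have htri : ‖z - z₀‖ ≤ ‖z - p‖ + ‖p - z₀‖ := norm_sub_le_norm_sub_add_norm_sub z p z₀
    have h := hmax' z (by rw [mem_closedBall_iff_norm]; linarith)
    have h' : (R - ‖p - z₀‖) / 2 * ‖deriv f z‖ ≤ (R - ‖z - z₀‖) * ‖deriv f z‖ :=
      mul_le_mul_of_nonneg_right (by linarith) (norm_nonneg _)
    refine le_of_mul_le_mul_left ?_ hs
    linarith

theorem Real.exists_cosh_pi_mul_eq_intCast_of_nonneg {t : ℝ} (ht : 0 ≤ t) :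
    ∃ y : ℝ, |y - t| ≤ 1 ∧ ∃ n : ℤ, Real.cosh (Real.pi * y) = n := by
  have hpi := Real.pi_gt_three
  have h2 : 2 ≤ Real.cosh Real.pi := by
    rw [Real.cosh_eq]
    linarith [Real.add_one_le_exp Real.pi, Real.exp_pos (-Real.pi)]
  have hstep : Real.cosh (Real.pi * t) + 1 ≤ Real.cosh (Real.pi * (t + 1)) := by
    rw [mul_add, mul_one, Real.cosh_add]
    have h1 := Real.one_le_cosh (Real.pi * t)
    have h3 : 0 ≤ Real.sinh (Real.pi * t) := Real.sinh_nonneg_iff.mpr (by positivity)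
    have h4 : 0 ≤ Real.sinh Real.pi := Real.sinh_nonneg_iff.mpr (by positivity)
    nlinarith [mul_nonneg h3 h4]
  obtain ⟨y, hy, hye⟩ := intermediate_value_Icc (f := fun y => Real.cosh (Real.pi * y))
    (by linarith : t ≤ t + 1) (Continuous.continuousOn (by fun_prop))
    (show (⌈Real.cosh (Real.pi * t)⌉ : ℝ) ∈ _ from
      ⟨Int.le_ceil _, (Int.ceil_lt_add_one _).le.trans hstep⟩)
  exact ⟨y, abs_le.mpr ⟨by linarith [hy.1], by linarith [hy.2]⟩, _, hye⟩

theorem Real.exists_cosh_pi_mul_eq_intCast (t : ℝ) :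
    ∃ y : ℝ, |y - t| ≤ 1 ∧ ∃ n : ℤ, Real.cosh (Real.pi * y) = n := by
  rcases le_total 0 t with ht | ht
  · exact Real.exists_cosh_pi_mul_eq_intCast_of_nonneg ht
  · obtain ⟨y, hy, n, hn⟩ := Real.exists_cosh_pi_mul_eq_intCast_of_nonneg (neg_nonneg.mpr ht)
    refine ⟨-y, ?_, n, by rw [mul_neg, Real.cosh_neg, hn]⟩
    rw [← abs_neg]
    convert hy using 2
    ring

/-- The solutions of `cos (π z) ∈ ℤ` meet every disc of radius `2`. -/
theorem Complex.exists_mem_ball_cos_pi_mul_eq_intCast (c : ℂ) :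
    ∃ z ∈ Metric.ball c 2, ∃ n : ℤ, Complex.cos (Real.pi * z) = n := by
  obtain ⟨y, hy, n, hn⟩ := Real.exists_cosh_pi_mul_eq_intCast c.im
  refine ⟨(round c.re : ℤ) + y * Complex.I, ?_, (round c.re).negOnePow * n, ?_⟩
  · rw [mem_ball_iff_norm]
    refine (Complex.norm_le_abs_re_add_abs_im _).trans_lt ?_
    have h := abs_sub_round c.re
    rw [abs_sub_comm] at h
    simp only [Complex.sub_re, Complex.add_re, Complex.intCast_re, Complex.mul_re,
      Complex.ofReal_re, Complex.I_re, Complex.ofReal_im, Complex.I_im, Complex.sub_im,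
      Complex.add_im, Complex.intCast_im, Complex.mul_im]
    norm_num
    linarith
  · have h1 : (Real.pi : ℂ) * ((round c.re : ℤ) + y * Complex.I) =
        ((Real.pi * y : ℝ) : ℂ) * Complex.I + (round c.re : ℤ) * Real.pi := by
      push_cast
      ring
    rw [h1, Complex.cos_antiperiodic.add_int_mul_eq, Complex.cos_mul_I, ← Complex.ofReal_cosh, hn]
    push_cast
    rfl

theorem Complex.cos_pi_mul_intCast_sq (n : ℤ) : Complex.cos (Real.pi * n) ^ 2 = 1 := by
  have h := Complex.sin_sq_add_cos_sq (Real.pi * n)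
  rw [mul_comm, Complex.sin_int_mul_pi] at h
  rw [mul_comm]
  simpa using h

/-- **Picard's little theorem**: an entire function omitting two values is constant. -/
theorem Complex.apply_eq_apply_of_forall_ne_of_forall_ne {f : ℂ → ℂ}
    (hf : Differentiable ℂ f) {a b : ℂ} (hab : a ≠ b) (ha : ∀ z, f z ≠ a) (hb : ∀ z, f z ≠ b)
    (z w : ℂ) : f z = f w := by
  have hba : b - a ≠ 0 := sub_ne_zero.mpr hab.symm
  have hpi : (Real.pi : ℂ) ≠ 0 := Complex.ofReal_ne_zero.mpr Real.pi_ne_zero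
  obtain ⟨g, hg, hge⟩ := Complex.exists_differentiable_cos_eq (f := fun z => (2 * f z - a - b) / (b - a))
    (by fun_prop)
    (fun z hz => hb z (by field_simp at hz; linear_combination hz / 2))
    (fun z hz => ha z (by field_simp at hz; linear_combination hz / 2))
  have hne : ∀ z, Complex.cos (g z) ^ 2 ≠ 1 := by
    intro z hz
    rw [hge z] at hz
    rcases sq_eq_sq_iff_eq_or_eq_neg.mp (hz.trans (one_pow 2).symm) with h | h
    · exact hb z (by field_simp at h; linear_combination h / 2)
    · exact ha z (by field_simp at h; linear_combination h / 2)
  have hint : ∀ (n : ℤ) z, g z / Real.pi ≠ n := by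
    intro n z hz
    apply hne z
    rw [← Complex.cos_pi_mul_intCast_sq n, ← hz, mul_div_cancel₀ _ hpi]
  obtain ⟨k, hk, hke⟩ := Complex.exists_differentiable_cos_eq (f := fun z => g z / Real.pi)
    (by fun_prop) (fun z => by simpa using hint 1 z) (fun z => by simpa using hint (-1) z)
  have hk0 : ∀ z, deriv k z = 0 := by
    intro z
    by_contra hz
    have hd : deriv (fun z => k z / Real.pi) z ≠ 0 := by
      rw [deriv_div_const]
      exact div_ne_zero hz hpi
    obtain ⟨c, hc⟩ := Complex.exists_ball_subset_range_of_differentiable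
      (f := fun z => k z / Real.pi) (by fun_prop) hd
      (R := 96 / ‖deriv (fun z => k z / Real.pi) z‖) (by positivity)
    obtain ⟨ζ, hζ, n, hn⟩ := Complex.exists_mem_ball_cos_pi_mul_eq_intCast c
    have hrad : 96 / ‖deriv (fun z => k z / Real.pi) z‖ *
        ‖deriv (fun z => k z / Real.pi) z‖ / 48 = 2 := by
      rw [div_mul_cancel₀ _ (norm_ne_zero_iff.mpr hd)]
      norm_num
    rw [hrad] at hc
    obtain ⟨x, hx⟩ := hc hζ
    apply hint n x
    rw [← hke x, ← hn, ← hx]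
    simp only [mul_div_cancel₀ _ hpi]
  have hkc := is_const_of_deriv_eq_zero hk hk0 z w
  have hgc : g z = g w := by
    have h1 := hke z
    rw [hkc, hke w] at h1
    exact (div_left_inj' hpi).mp h1.symm
  have h2 := hge z
  rw [hgc, hge w] at h2
  field_simp at h2
  linear_combination -h2 / 2

/-- A form of **Hurwitz's theorem**: if `f (·, w₀)` is a nonconstant entire function taking the
value `b`, then for `w` near `w₀` the function `f (·, w)` takes all values near `b`. -/
theorem AnalyticOnNhd.eventually_exists_apply_eq {D : Set ℂ} (hD : IsOpen D) {f : ℂ × ℂ → ℂ}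
    (hf : AnalyticOnNhd ℂ f (Set.univ ×ˢ D)) {w₀ z₀ : ℂ} (hw₀ : w₀ ∈ D)
    (hnc : ∀ w ∈ D, ∃ z₁ z₂ : ℂ, f (z₁, w) ≠ f (z₂, w)) :
    ∀ᶠ q : ℂ × ℂ in nhds (w₀, f (z₀, w₀)), ∃ z, f (z, q.1) = q.2 := by
  have hslice : ∀ w ∈ D, AnalyticOnNhd ℂ (fun z => f (z, w)) Set.univ := fun w hw z _ =>
    (hf (z, w) ⟨Set.mem_univ _, hw⟩).along_fst
  have hcont : ∀ z, ∀ w ∈ D, ContinuousAt f (z, w) := fun z w hw =>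
    (hf (z, w) ⟨Set.mem_univ _, hw⟩).continuousAt
  have hisol : ∀ w ∈ D, ∀ᶠ z in nhdsWithin z₀ {z₀}ᶜ, f (z, w) ≠ f (z₀, w) := by
    intro w hw
    by_contra h
    have h' : ∃ᶠ z in nhdsWithin z₀ {z₀}ᶜ, f (z, w) = f (z₀, w) := by
      simpa [Filter.not_eventually] using h
    have heq := (hslice w hw).eq_of_frequently_eq analyticOnNhd_const h'
    obtain ⟨z₁, z₂, hne⟩ := hnc w hw
    exact hne ((congrFun heq z₁).trans (congrFun heq z₂).symm)
  obtain ⟨r, hr, hball⟩ := Metric.nhds_basis_closedBall.eventually_iff.mp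
    (eventually_nhdsWithin_iff.mp (hisol w₀ hw₀))
  have hsph : ∀ z ∈ Metric.sphere z₀ r, 0 < ‖f (z, w₀) - f (z₀, w₀)‖ := fun z hz =>
    norm_pos_iff.mpr (sub_ne_zero.mpr (hball (Metric.sphere_subset_closedBall hz)
      (Metric.ne_of_mem_sphere hz hr.ne')))
  obtain ⟨x, hx, hmin⟩ := (isCompact_sphere z₀ r).exists_isMinOn
    (NormedSpace.sphere_nonempty.mpr hr.le)
    (f := fun z => ‖f (z, w₀) - f (z₀, w₀)‖)
    (((hslice w₀ hw₀).continuousOn.sub continuousOn_const).norm.mono (Set.subset_univ _))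
  set ε := ‖f (x, w₀) - f (z₀, w₀)‖ / 2 with hε
  have hε0 : 0 < ε := half_pos (hsph x hx)
  have hunif : ∀ᶠ w in nhds w₀, ∀ z ∈ Metric.sphere z₀ r, ε < ‖f (z, w) - f (z₀, w)‖ := by
    refine (isCompact_sphere z₀ r).eventually_forall_of_forall_eventually fun z hz => ?_
    have h1 : ContinuousAt (fun q : ℂ × ℂ => f (q.2, q.1)) (w₀, z) :=
      (hcont z w₀ hw₀).comp_of_eq (by fun_prop) rfl
    have h2 : ContinuousAt (fun q : ℂ × ℂ => f (z₀, q.1)) (w₀, z) :=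
      (hcont z₀ w₀ hw₀).comp_of_eq (by fun_prop) rfl
    refine (h1.sub h2).norm.eventually_const_lt ?_
    have h3 : ‖f (x, w₀) - f (z₀, w₀)‖ ≤ ‖f (z, w₀) - f (z₀, w₀)‖ := hmin hz
    show ε < ‖f (z, w₀) - f (z₀, w₀)‖
    linarith
  have hfst : Filter.Tendsto Prod.fst (nhds (w₀, f (z₀, w₀))) (nhds w₀) :=
    continuous_fst.tendsto _
  have hdist : ∀ᶠ q : ℂ × ℂ in nhds (w₀, f (z₀, w₀)), ‖q.2 - f (z₀, q.1)‖ < ε / 2 := by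
    have h2 : ContinuousAt (fun q : ℂ × ℂ => f (z₀, q.1)) (w₀, f (z₀, w₀)) :=
      (hcont z₀ w₀ hw₀).comp_of_eq (by fun_prop) rfl
    refine (continuousAt_snd.sub h2).norm.eventually_lt_const ?_
    simpa using hε0
  filter_upwards [hfst.eventually hunif, hfst.eventually (hD.eventually_mem hw₀), hdist]
    with q hq hqD hqd
  have hdiff : Differentiable ℂ fun z => f (z, q.1) := fun z =>
    ((hslice q.1 hqD) z (Set.mem_univ z)).differentiableAt
  obtain ⟨z, _, hz⟩ := hdiff.diffContOnCl.ball_subset_image_closedBall hr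
    (fun z hz => (hq z hz).le)
    ((hisol q.1 hqD).frequently.filter_mono nhdsWithin_le_nhds)
    (mem_ball_iff_norm.mpr hqd)
  exact ⟨z, hz⟩

/-- If `f : ℂ × D → ℂ` is holomorphic, `D ⊆ ℂ` open, all functions `z ↦ f (z, w)`
nonconstant, and `a : D → ℂ` is a selection of exceptional values
(`f (z, w) ≠ a w` for all `z` and all `w ∈ D`), then the graph of `a` over `D` is
closed in `D × ℂ`. -/
theorem stmt_12
    (D : Set ℂ) (hD : IsOpen D)
    (f : ℂ × ℂ → ℂ)
    (hf : AnalyticOnNhd ℂ f (Set.univ ×ˢ D))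
    (hnc : ∀ w ∈ D, ∃ z₁ z₂ : ℂ, f (z₁, w) ≠ f (z₂, w))
    (a : ℂ → ℂ)
    (ha : ∀ w ∈ D, ∀ z : ℂ, f (z, w) ≠ a w) :
    ∀ p : ℂ × ℂ, p ∈ closure {q : ℂ × ℂ | q.1 ∈ D ∧ q.2 = a q.1} → p.1 ∈ D →
      p ∈ {q : ℂ × ℂ | q.1 ∈ D ∧ q.2 = a q.1} := by
  rintro ⟨w₀, b⟩ hp hw₀
  refine ⟨hw₀, ?_⟩
  have hw₀' : w₀ ∈ D := hw₀
  by_contra hne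
  have hb : ∀ z, f (z, w₀) ≠ b := by
    rintro z rfl
    obtain ⟨q, ⟨hqD, hqa⟩, z', hz'⟩ := ((mem_closure_iff_frequently.mp hp).and_eventually
      (hf.eventually_exists_apply_eq hD hw₀' hnc)).exists
    exact ha q.1 hqD z' (hz'.trans hqa)
  obtain ⟨z₁, z₂, h12⟩ := hnc w₀ hw₀'
  have hdiff : Differentiable ℂ fun z => f (z, w₀) := fun z =>
    (hf (z, w₀) ⟨Set.mem_univ _, hw₀'⟩).along_fst.differentiableAt
  exact h12 (Complex.apply_eq_apply_of_forall_ne_of_forall_ne hdiff hne hb (ha w₀ hw₀') z₁ z₂)
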